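/- arXiv:1406.1619 — 4 statements merged into one kernel-verified Lean document; each statement's English description precedes it below -/
import Mathlib

section
/- The noise Jacobian of the unicycle dynamics, rotated into the Frénet frame, is a constant matrix: for every state (x, y, θ) and inputs (u, ω), the Jacobian of the map (v, w) ↦ f((x, y, θ), (u, ω), (v, w)) at (v, w) = (0, 0) equals the 3×2 matrix τ·((cos θ, 0), (sin θ, 0), (0, 1)), and Υ_{−θ} · τ·((cos θ, 0), (sin θ, 0), (0, 1)) = τ·((1, 0), (0, 0), (0, 1)), which does not depend on (x, y, θ) or (u, ω). -/
open Matrix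

/-- Discrete-time unicycle dynamics with time step `τ`. -/
noncomputable def fdyn (τ : ℝ) (χ : Fin 3 → ℝ) (u : Fin 2 → ℝ) (m : Fin 2 → ℝ) :
    Fin 3 → ℝ :=
  ![χ 0 + τ * (u 0 + m 0) * Real.cos (χ 2),
    χ 1 + τ * (u 0 + m 0) * Real.sin (χ 2),
    χ 2 + τ * (u 1 + m 1)]

/-- `Υ_φ`: block-diagonal matrix with upper-left block the planar rotation `R_φ`
and lower-right entry `1`. -/
noncomputable def Ups (φ : ℝ) : Matrix (Fin 3) (Fin 3) ℝ :=
  !![Real.cos φ, -Real.sin φ, 0;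
     Real.sin φ,  Real.cos φ, 0;
     0,           0,          1]

/-- The unicycle dynamics is affine in the noise. -/
theorem fdyn_eq_mulVec_add (τ : ℝ) (χ : Fin 3 → ℝ) (u m : Fin 2 → ℝ) :
    fdyn τ χ u m =
      (τ • !![Real.cos (χ 2), 0; Real.sin (χ 2), 0; 0, 1]) *ᵥ m + fdyn τ χ u 0 := by
  ext i
  fin_cases i <;> simp [fdyn, dotProduct, Fin.sum_univ_two] <;> ring

/-- Rotating the noise Jacobian into the Frénet frame gives a constant matrix. -/
theorem Ups_neg_mul_noise_jacobian (τ θ : ℝ) :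
    Ups (-θ) * (τ • !![Real.cos θ, 0; Real.sin θ, 0; 0, 1]) =
      τ • !![(1 : ℝ), 0; 0, 0; 0, 1] := by
  rw [Matrix.mul_smul]
  congr 1
  ext i j
  fin_cases i <;> fin_cases j <;>
    simp [Ups, Matrix.mul_apply, Fin.sum_univ_three, ← sq, mul_comm]

theorem unicycle_noise_jacobian_frenet_constant (τ : ℝ) (hτ : 0 < τ)
    (χ : Fin 3 → ℝ) (u : Fin 2 → ℝ) :
    HasFDerivAt (fun m : Fin 2 → ℝ => fdyn τ χ u m)
      (LinearMap.toContinuousLinearMap (Matrix.toLin'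
        (τ • !![Real.cos (χ 2), 0;
                Real.sin (χ 2), 0;
                0,              1]))) 0 ∧
    Ups (-(χ 2)) * (τ • !![Real.cos (χ 2), 0;
                           Real.sin (χ 2), 0;
                           0,              1]) =
      τ • !![(1 : ℝ), 0;
             0,       0;
             0,       1] := by
  refine ⟨?_, Ups_neg_mul_noise_jacobian τ (χ 2)⟩
  rw [show (fun m => fdyn τ χ u m) = _ from funext (fdyn_eq_mulVec_add τ χ u)]
  refine HasFDerivAt.add_const _ ?_
  exact ContinuousLinearMap.hasFDerivAt (LinearMap.toContinuousLinearMap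
    (Matrix.toLin' (τ • !![Real.cos (χ 2), 0; Real.sin (χ 2), 0; 0, 1])))
end

section
/- The state Jacobian of the unicycle dynamics is equivariant under the SE(2) action: for every state (x, y, θ), inputs (u, ω), and group element g = (x⁰, y⁰, θ⁰), the Jacobian of χ ↦ f(χ, (u, ω), (0,0)) at g·(x, y, θ) equals Υ_{θ⁰} · A(θ, u) · Υ_{−θ⁰}, where A(θ, u) = ((1, 0, −τ u sin θ), (0, 1, τ u cos θ), (0, 0, 1)) is the Jacobian at (x, y, θ). -/
open Matrix

/-- Action of `g = (x⁰, y⁰, θ⁰) ∈ ℝ² × ℝ` (SE(2)) on a state `(x, y, θ)`. -/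
noncomputable def act (g : (ℝ × ℝ) × ℝ) (χ : Fin 3 → ℝ) : Fin 3 → ℝ :=
  ![g.1.1 + χ 0 * Real.cos g.2 - χ 1 * Real.sin g.2,
    g.1.2 + χ 0 * Real.sin g.2 + χ 1 * Real.cos g.2,
    χ 2 + g.2]

/-- The state Jacobian of the unicycle dynamics at a state with heading `θ`. -/
noncomputable def Amat (τ θ u : ℝ) : Matrix (Fin 3) (Fin 3) ℝ :=
  !![1, 0, -τ * u * Real.sin θ;
     0, 1,  τ * u * Real.cos θ;
     0, 0, 1]

/-- Conjugating the state Jacobian by a rotation shifts its heading. -/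
theorem Ups_mul_Amat_mul_Ups_neg (τ θ v φ : ℝ) :
    Ups φ * Amat τ θ v * Ups (-φ) = Amat τ (θ + φ) v := by
  have h := Real.sin_sq_add_cos_sq φ
  ext i j
  fin_cases i <;> fin_cases j <;>
    simp [Ups, Amat, Matrix.mul_apply, Fin.sum_univ_three, Real.sin_add, Real.cos_add] <;>
    linarith

/-- `Amat` is the state Jacobian of the noise-free unicycle dynamics. -/
theorem hasFDerivAt_fdyn (τ : ℝ) (χ : Fin 3 → ℝ) (u : Fin 2 → ℝ) :
    HasFDerivAt (fun χ' : Fin 3 → ℝ => fdyn τ χ' u 0)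
      (LinearMap.toContinuousLinearMap (Matrix.toLin' (Amat τ (χ 2) (u 0)))) χ := by
  have coord (i : Fin 3) : HasFDerivAt (fun χ' : Fin 3 → ℝ => χ' i)
      (ContinuousLinearMap.proj (R := ℝ) (φ := fun _ : Fin 3 => ℝ) i) χ :=
    hasFDerivAt_apply i χ
  rw [hasFDerivAt_pi']
  intro i
  fin_cases i
  · refine ((coord 0).add ((coord 2).cos.const_mul (τ * (u 0 + 0)))).congr_fderiv ?_
    ext w
    simp [Amat, dotProduct, Fin.sum_univ_three]
    ring
  · refine ((coord 1).add ((coord 2).sin.const_mul (τ * (u 0 + 0)))).congr_fderiv ?_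
    ext w
    simp [Amat, dotProduct, Fin.sum_univ_three]
    ring
  · refine ((coord 2).add_const (τ * (u 1 + 0))).congr_fderiv ?_
    ext w
    simp [Amat, dotProduct, Fin.sum_univ_three]

theorem unicycle_state_jacobian_equivariant (τ : ℝ) (hτ : 0 < τ)
    (χ : Fin 3 → ℝ) (u : Fin 2 → ℝ) (g : (ℝ × ℝ) × ℝ) :
    HasFDerivAt (fun χ' : Fin 3 → ℝ => fdyn τ χ' u 0)
      (LinearMap.toContinuousLinearMap (Matrix.toLin'
        (Ups g.2 * Amat τ (χ 2) (u 0) * Ups (-g.2)))) (act g χ) := by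
  rw [Ups_mul_Amat_mul_Ups_neg]
  exact hasFDerivAt_fdyn τ (act g χ) u
end

section
/- Optimality of the Kalman gain: let P ∈ ℝ^{d×d} and N ∈ ℝ^{p×p} be symmetric positive semidefinite matrices and H ∈ ℝ^{p×d} be such that S := H P Hᵀ + N is positive definite, and set K* = P Hᵀ S⁻¹. Then for every K ∈ ℝ^{d×p}, tr((I − K H) P (I − K H)ᵀ + K N Kᵀ) ≥ tr((I − K* H) P), with equality when K = K*. -/
open Matrix

/-- Completing the square: if `L * S = P * Hᵀ` for the innovation covariance
`S = H * P * Hᵀ + N`, the Joseph form at `K` is `(1 - L * H) * P` plus a quadratic term in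
`K - L`. -/
theorem joseph_form_eq_add_mul_mul_transpose {m n R : Type*} [Fintype m] [Fintype n]
    [DecidableEq m] [CommRing R] {P : Matrix m m R} {N : Matrix n n R} {H : Matrix n m R}
    {L : Matrix m n R} (hP : Pᵀ = P) (hN : Nᵀ = N)
    (hL : L * (H * P * Hᵀ + N) = P * Hᵀ) (K : Matrix m n R) :
    (1 - K * H) * P * (1 - K * H)ᵀ + K * N * Kᵀ =
      (1 - L * H) * P + (K - L) * (H * P * Hᵀ + N) * (K - L)ᵀ := by
  have hL' : (H * P * Hᵀ + N) * Lᵀ = H * P := by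
    simpa [transpose_mul, hP, hN, Matrix.mul_assoc] using congrArg transpose hL
  have hsq : (K - L) * (H * P * Hᵀ + N) * (K - L)ᵀ =
      K * (H * P * Hᵀ + N) * Kᵀ - K * (H * P) - P * Hᵀ * Kᵀ + L * (H * P) := by
    rw [Matrix.sub_mul, hL, transpose_sub, Matrix.mul_sub, Matrix.sub_mul, Matrix.sub_mul,
      Matrix.mul_assoc K _ Lᵀ, hL', ← hL, Matrix.mul_assoc L _ Lᵀ, hL']
    abel
  rw [hsq]
  simp only [transpose_sub, transpose_one, transpose_mul, Matrix.sub_mul, Matrix.mul_sub,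
    Matrix.add_mul, Matrix.mul_add, Matrix.one_mul, Matrix.mul_one, Matrix.mul_assoc]
  abel

theorem kalman_gain_optimality
    {d p : ℕ} (P : Matrix (Fin d) (Fin d) ℝ) (N : Matrix (Fin p) (Fin p) ℝ)
    (H : Matrix (Fin p) (Fin d) ℝ)
    (hP : P.PosSemidef) (hN : N.PosSemidef)
    (hS : (H * P * Hᵀ + N).PosDef) :
    let Kstar := P * Hᵀ * (H * P * Hᵀ + N)⁻¹
    (∀ K : Matrix (Fin d) (Fin p) ℝ,
      ((1 - K * H) * P * (1 - K * H)ᵀ + K * N * Kᵀ).trace ≥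
        ((1 - Kstar * H) * P).trace) ∧
    ((1 - Kstar * H) * P * (1 - Kstar * H)ᵀ + Kstar * N * Kstarᵀ).trace =
      ((1 - Kstar * H) * P).trace := by
  intro Kstar
  have hL : Kstar * (H * P * Hᵀ + N) = P * Hᵀ :=
    nonsing_inv_mul_cancel_right _ _ ((isUnit_iff_isUnit_det _).mp hS.isUnit)
  have joseph := joseph_form_eq_add_mul_mul_transpose
    (by simpa using hP.isHermitian.eq) (by simpa using hN.isHermitian.eq) hL
  refine ⟨fun K => ?_, by rw [joseph Kstar]; simp⟩
  have hpsd := (hS.posSemidef.mul_mul_conjTranspose_same (K - Kstar)).trace_nonneg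
  rw [conjTranspose_eq_transpose_of_trivial] at hpsd
  rw [joseph K, trace_add]
  linarith
end

section
/- Finite-horizon linear-quadratic regulator optimality via the backwards Riccati recursion: let n ∈ ℕ, and for 0 ≤ t < n let A_t ∈ ℝ^{d×d} and B_t ∈ ℝ^{d×k}; let C ∈ ℝ^{d×d} be symmetric positive semidefinite and D ∈ ℝ^{k×k} symmetric positive definite. Define S_n = C and, backwards for t = n−1, ..., 0: L_t = −(B_tᵀ S_{t+1} B_t + D)⁻¹ B_tᵀ S_{t+1} A_t and S_t = C + A_tᵀ S_{t+1} A_t + A_tᵀ S_{t+1} B_t L_t. Then for every initial state x_0 ∈ ℝ^d and every control sequence u_0, ..., u_{n−1} ∈ ℝ^k, the cost Σ_{t=0}^{n} x_tᵀ C x_t + Σ_{t=0}^{n−1} u_tᵀ D u_t of the trajectory x_{t+1} = A_t x_t + B_t u_t satisfies cost ≥ x_0ᵀ S_0 x_0, with equality if and only if u_t = L_t x_t for all 0 ≤ t < n. -/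
open Matrix Finset

lemma dotProduct_mulVec_comm_of_isSymm {m : Type*} [Fintype m] {Q : Matrix m m ℝ}
    (hQ : Q.IsSymm) (v w : m → ℝ) : v ⬝ᵥ Q *ᵥ w = w ⬝ᵥ Q *ᵥ v := by
  rw [dotProduct_mulVec, ← mulVec_transpose, hQ.eq, dotProduct_comm]

lemma dotProduct_transpose_mulVec_eq {m p : Type*} [Fintype m] [Fintype p] (Q : Matrix m p ℝ)
    (v : p → ℝ) (w : m → ℝ) : v ⬝ᵥ Qᵀ *ᵥ w = (Q *ᵥ v) ⬝ᵥ w := by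
  rw [mulVec_transpose, dotProduct_comm, ← dotProduct_mulVec, dotProduct_comm]

/-- Completion of the square in the one-step Bellman equation: `P` is the cost-to-go matrix at the
next time and `L` is the feedback gain, characterised by its normal equation. -/
lemma riccati_completion_of_square {m p : Type*} [Fintype m] [Fintype p]
    {A C P : Matrix m m ℝ} {B : Matrix m p ℝ} {D : Matrix p p ℝ} {L : Matrix p m ℝ}
    (hP : P.IsSymm) (hD : D.IsSymm) (hL : (Bᵀ * P * B + D) * L = -(Bᵀ * P * A))
    (x : m → ℝ) (u : p → ℝ) :
    x ⬝ᵥ C *ᵥ x + u ⬝ᵥ D *ᵥ u + (A *ᵥ x + B *ᵥ u) ⬝ᵥ P *ᵥ (A *ᵥ x + B *ᵥ u) =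
      x ⬝ᵥ (C + Aᵀ * P * A + Aᵀ * P * B * L) *ᵥ x +
        (u - L *ᵥ x) ⬝ᵥ (Bᵀ * P * B + D) *ᵥ (u - L *ᵥ x) := by
  have normal (v : p → ℝ) := congrArg (fun Q => v ⬝ᵥ Q *ᵥ x) hL
  simp only [← mulVec_mulVec, add_mulVec, mulVec_add, mulVec_sub, neg_mulVec, dotProduct_add,
    add_dotProduct, sub_dotProduct, dotProduct_sub, dotProduct_neg,
    dotProduct_transpose_mulVec_eq] at normal ⊢
  have h₁ := normal u
  have h₂ := normal (L *ᵥ x)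
  have hAu := dotProduct_mulVec_comm_of_isSymm hP (B *ᵥ u) (A *ᵥ x)
  have hAL := dotProduct_mulVec_comm_of_isSymm hP (B *ᵥ L *ᵥ x) (A *ᵥ x)
  have hBu := dotProduct_mulVec_comm_of_isSymm hP (B *ᵥ u) (B *ᵥ L *ᵥ x)
  have hDu := dotProduct_mulVec_comm_of_isSymm hD u (L *ᵥ x)
  linarith

/-- One step of the backwards Riccati recursion preserves positive semidefiniteness. -/
lemma riccati_step_posSemidef {m p : Type*} [Fintype m] [Fintype p]
    {A C P : Matrix m m ℝ} {B : Matrix m p ℝ} {D : Matrix p p ℝ} {L : Matrix p m ℝ}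
    (hC : C.PosSemidef) (hP : P.PosSemidef) (hD : D.PosSemidef)
    (hL : (Bᵀ * P * B + D) * L = -(Bᵀ * P * A)) :
    (C + Aᵀ * P * A + Aᵀ * P * B * L).PosSemidef := by
  have hCs : Cᵀ = C := by simpa using hC.isHermitian.eq
  have hPs : Pᵀ = P := by simpa using hP.isHermitian.eq
  have hDs : Dᵀ = D := by simpa using hD.isHermitian.eq
  have hcross : Aᵀ * P * B * L = -(Lᵀ * (Bᵀ * P * B + D) * L) := by
    have h := congrArg (fun Q => Qᵀ * L) hL
    simp only [transpose_mul, transpose_add, transpose_neg, transpose_transpose, hPs, hDs,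
      Matrix.neg_mul, ← Matrix.mul_assoc] at h
    rw [h, neg_neg]
  refine PosSemidef.of_dotProduct_mulVec_nonneg ?_ fun x => ?_
  · rw [hcross]
    simp only [IsHermitian, conjTranspose_eq_transpose_of_trivial, transpose_add, transpose_neg,
      transpose_mul, transpose_transpose, hCs, hPs, hDs, Matrix.mul_assoc]
  · have h := riccati_completion_of_square (C := C) hPs hDs hL x (L *ᵥ x)
    rw [sub_self, zero_dotProduct, add_zero] at h
    rw [star_trivial, ← h]
    have h₁ := hC.dotProduct_mulVec_nonneg x
    have h₂ := hD.dotProduct_mulVec_nonneg (L *ᵥ x)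
    have h₃ := hP.dotProduct_mulVec_nonneg (A *ᵥ x + B *ᵥ L *ᵥ x)
    simp only [star_trivial] at h₁ h₂ h₃
    positivity

theorem lqr_riccati_optimality
    {d k : ℕ} (n : ℕ)
    (A : ℕ → Matrix (Fin d) (Fin d) ℝ) (B : ℕ → Matrix (Fin d) (Fin k) ℝ)
    (C : Matrix (Fin d) (Fin d) ℝ) (D : Matrix (Fin k) (Fin k) ℝ)
    (hC : C.PosSemidef) (hD : D.PosDef)
    -- the backwards Riccati recursion
    (S : ℕ → Matrix (Fin d) (Fin d) ℝ) (L : ℕ → Matrix (Fin k) (Fin d) ℝ)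
    (hSn : S n = C)
    (hL : ∀ t < n, L t = -((B t)ᵀ * S (t + 1) * B t + D)⁻¹ * (B t)ᵀ * S (t + 1) * A t)
    (hS : ∀ t < n, S t = C + (A t)ᵀ * S (t + 1) * A t + (A t)ᵀ * S (t + 1) * B t * L t)
    -- an arbitrary control sequence and the associated trajectory
    (u : ℕ → Fin k → ℝ) (x : ℕ → Fin d → ℝ)
    (hx : ∀ t < n, x (t + 1) = (A t).mulVec (x t) + (B t).mulVec (u t)) :
    (∑ t ∈ Finset.range (n + 1), x t ⬝ᵥ C.mulVec (x t)) +
        (∑ t ∈ Finset.range n, u t ⬝ᵥ D.mulVec (u t)) ≥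
      x 0 ⬝ᵥ (S 0).mulVec (x 0) ∧
    ((∑ t ∈ Finset.range (n + 1), x t ⬝ᵥ C.mulVec (x t)) +
        (∑ t ∈ Finset.range n, u t ⬝ᵥ D.mulVec (u t)) =
      x 0 ⬝ᵥ (S 0).mulVec (x 0) ↔ ∀ t < n, u t = (L t).mulVec (x t)) := by
  have hM_of {t : ℕ} (h : (S (t + 1)).PosSemidef) :
      ((B t)ᵀ * S (t + 1) * B t + D).PosDef := by
    have h := h.conjTranspose_mul_mul_same (B t)
    rw [conjTranspose_eq_transpose_of_trivial] at h
    exact PosDef.posSemidef_add h hD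
  have normal {t : ℕ} (ht : t < n) (h : (S (t + 1)).PosSemidef) :
      ((B t)ᵀ * S (t + 1) * B t + D) * L t = -((B t)ᵀ * S (t + 1) * A t) := by
    have hdet := (isUnit_iff_isUnit_det _).mp (hM_of h).isUnit
    rw [hL t ht, Matrix.neg_mul, Matrix.neg_mul, Matrix.neg_mul, Matrix.mul_neg,
      Matrix.mul_assoc (_⁻¹ * _), Matrix.mul_assoc _⁻¹, mul_nonsing_inv_cancel_left _ _ hdet,
      Matrix.mul_assoc]
  have hSpos {t : ℕ} (ht : t ≤ n) : (S t).PosSemidef := by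
    induction ht using Nat.decreasingInduction with
    | self => exact hSn ▸ hC
    | of_succ t ht ih =>
      rw [hS t ht]
      exact riccati_step_posSemidef hC ih hD.posSemidef (normal ht ih)
  have hM {t : ℕ} (ht : t < n) := hM_of (hSpos (Nat.succ_le_of_lt ht))
  let gap (t : ℕ) : ℝ := (u t - L t *ᵥ x t) ⬝ᵥ
    ((B t)ᵀ * S (t + 1) * B t + D) *ᵥ (u t - L t *ᵥ x t)
  have hgap {t : ℕ} (ht : t < n) : 0 ≤ gap t := by
    simpa only [star_trivial] using (hM ht).posSemidef.dotProduct_mulVec_nonneg (u t - L t *ᵥ x t)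
  have hgap_zero {t : ℕ} (ht : t < n) : gap t = 0 ↔ u t = L t *ᵥ x t := by
    refine ⟨fun h => ?_, fun h => by simp [gap, h]⟩
    by_contra hne
    have hpos := (hM ht).dotProduct_mulVec_pos (sub_ne_zero.mpr hne)
    rw [star_trivial] at hpos
    exact hpos.ne' h
  have hcost : (∑ t ∈ range (n + 1), x t ⬝ᵥ C *ᵥ x t) + (∑ t ∈ range n, u t ⬝ᵥ D *ᵥ u t) =
      x 0 ⬝ᵥ S 0 *ᵥ x 0 + ∑ t ∈ range n, gap t := by
    have hstep : ∀ t ∈ range n, x t ⬝ᵥ C *ᵥ x t + u t ⬝ᵥ D *ᵥ u t =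
        gap t - (x (t + 1) ⬝ᵥ S (t + 1) *ᵥ x (t + 1) - x t ⬝ᵥ S t *ᵥ x t) := by
      intro t ht
      have ht := mem_range.mp ht
      have hP := hSpos (Nat.succ_le_of_lt ht)
      have h := riccati_completion_of_square (C := C) (by simpa [IsHermitian, IsSymm] using hP.isHermitian)
        (by simpa [IsHermitian, IsSymm] using hD.isHermitian) (normal ht hP) (x t) (u t)
      rw [← hS t ht, ← hx t ht] at h
      linarith
    have hsum := sum_congr rfl hstep
    rw [sum_add_distrib, sum_sub_distrib,
      sum_range_sub (fun t => x t ⬝ᵥ S t *ᵥ x t), hSn] at hsum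
    rw [sum_range_succ]
    linarith
  have hgap_mem : ∀ t ∈ range n, 0 ≤ gap t := fun t ht => hgap (mem_range.mp ht)
  rw [hcost]
  refine ⟨le_add_of_nonneg_right (sum_nonneg hgap_mem), ?_⟩
  rw [add_eq_left, sum_eq_zero_iff_of_nonneg hgap_mem]
  simp only [mem_range]
  exact forall₂_congr fun t ht => hgap_zero ht
end
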